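/- arXiv:2102.08676 — 2 statements merged into one kernel-verified Lean document; each statement's English description precedes it below -/
import Mathlib

section
/- The functional equation S_2(φ) + (φ²/(4π²)) S_2(4π²/φ) = φ²/6 + 2π²/3 - 2φ holds for all complex φ with Re(φ) > 0, where S_2(φ) = Σ_{n=1}^∞ φ²/sinh²(nφ/2). -/
lemma S2aux_sinh (w : ℂ) (hw : 0 < w.re) :
    ∑' c : ℕ+, (c : ℂ) * Complex.exp (-2 * w) ^ (c : ℕ) = 1 / (4 * Complex.sinh w ^ 2) := by
  have hr : ‖Complex.exp (-2 * w)‖ < 1 := by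
    rw [Complex.norm_exp]
    simpa using hw
  have h := tsum_coe_mul_geometric_of_norm_lt_one hr
  have h1 : ∑' c : ℕ+, (c : ℂ) * Complex.exp (-2 * w) ^ (c : ℕ)
      = ∑' c : ℕ, (c : ℂ) * Complex.exp (-2 * w) ^ c := by
    have hs : Summable (fun c : ℕ => (c : ℂ) * Complex.exp (-2 * w) ^ c) :=
      (hasSum_coe_mul_geometric_of_norm_lt_one hr).summable
    rw [hs.tsum_eq_zero_add, tsum_pnat_eq_tsum_succ
      (f := fun c : ℕ => (c : ℂ) * Complex.exp (-2 * w) ^ c)]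
    simp
  have hne : (1 - Complex.exp (-2 * w)) ≠ 0 := by
    intro h0
    rw [← sub_eq_zero.mp h0] at hr
    simp at hr
  have he : Complex.exp w ≠ 0 := Complex.exp_ne_zero w
  have hq : Complex.exp (-2 * w) = (Complex.exp w ^ 2)⁻¹ := by
    rw [← Complex.exp_nat_mul, ← Complex.exp_neg]
    push_cast
    ring_nf
  rw [h1, h, Complex.sinh, Complex.exp_neg]
  rw [hq] at hne ⊢
  have h2 : Complex.exp w ^ 2 - 1 ≠ 0 := by
    intro h0
    apply hne
    rw [sub_eq_zero.mp h0]
    simp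
  have h3 : 1 - (Complex.exp w ^ 2)⁻¹ = (Complex.exp w ^ 2 - 1) / Complex.exp w ^ 2 := by
    field_simp
  have h4 : Complex.exp w - (Complex.exp w)⁻¹ = (Complex.exp w ^ 2 - 1) / Complex.exp w := by
    field_simp
  rw [h3, h4]
  field_simp
  norm_num

lemma S2aux_sum (φ : ℂ) (hφ : 0 < φ.re) (z : UpperHalfPlane)
    (hz : 2 * (Real.pi : ℂ) * Complex.I * z = -φ) :
    ∑' n : ℕ, φ ^ 2 / Complex.sinh (((n + 1 : ℕ) : ℂ) * φ / 2) ^ 2 =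
      φ ^ 2 / (2 * (Real.pi : ℂ) ^ 2) * (2 * riemannZeta 2 - EisensteinSeries.G2 z) := by
  have hG := EisensteinSeries.G2_eq_tsum_cexp z
  have hr : ‖Complex.exp (-φ)‖ < 1 := by
    rw [Complex.norm_exp]
    simpa using hφ
  rw [hz, ← tsum_prod_pow_eq_tsum_sigma 1 hr] at hG
  have h1 : ∀ d : ℕ+, ∑' c : ℕ+, (c : ℂ) ^ 1 * Complex.exp (-φ) ^ (d * c : ℕ) =
      1 / (4 * Complex.sinh (((d : ℕ) : ℂ) * φ / 2) ^ 2) := by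
    intro d
    rw [← S2aux_sinh]
    · refine tsum_congr fun c => ?_
      rw [pow_one, pow_mul, ← Complex.exp_nat_mul]
      ring_nf
    · have : ((d : ℕ) : ℂ) * φ / 2 = (((d : ℕ) : ℝ) / 2 : ℝ) * φ := by push_cast; ring
      rw [this, Complex.re_ofReal_mul]
      have := d.pos
      positivity
  simp_rw [h1] at hG
  rw [tsum_pnat_eq_tsum_succ
    (f := fun d : ℕ => 1 / (4 * Complex.sinh ((d : ℂ) * φ / 2) ^ 2))] at hG
  have h2 : ∑' n : ℕ, φ ^ 2 / Complex.sinh (((n + 1 : ℕ) : ℂ) * φ / 2) ^ 2 =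
      4 * φ ^ 2 * ∑' n : ℕ, 1 / (4 * Complex.sinh (((n + 1 : ℕ) : ℂ) * φ / 2) ^ 2) := by
    rw [← tsum_mul_left]
    refine tsum_congr fun n => ?_
    rw [mul_one_div, mul_div_mul_left _ _ (by norm_num)]
  have hpi : (Real.pi : ℂ) ≠ 0 := by exact_mod_cast Real.pi_ne_zero
  rw [h2, hG]
  field_simp
  ring

open Complex in
/-- The functional equation
`S_2(φ) + (φ²/(4π²)) S_2(4π²/φ) = φ²/6 + 2π²/3 - 2φ` for `Re φ > 0`,
where `S_2(φ) = Σ_{n≥1} φ²/sinh²(nφ/2)`. -/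
theorem S2_functional_equation (φ : ℂ) (hφ : 0 < φ.re) :
    (∑' n : ℕ, φ ^ 2 / Complex.sinh (((n + 1 : ℕ) : ℂ) * φ / 2) ^ 2) +
        φ ^ 2 / (4 * (Real.pi : ℂ) ^ 2) *
          ∑' n : ℕ,
            (4 * (Real.pi : ℂ) ^ 2 / φ) ^ 2 /
              Complex.sinh (((n + 1 : ℕ) : ℂ) * (4 * (Real.pi : ℂ) ^ 2 / φ) / 2) ^ 2 =
      φ ^ 2 / 6 + 2 * (Real.pi : ℂ) ^ 2 / 3 - 2 * φ := by
  have hpi : (Real.pi : ℂ) ≠ 0 := by exact_mod_cast Real.pi_ne_zero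
  have h0 : φ ≠ 0 := by rintro rfl; simp at hφ
  have him : 0 < (I * φ / (2 * (Real.pi : ℂ))).im := by
    have : I * φ / (2 * (Real.pi : ℂ)) = ((1 / (2 * Real.pi) : ℝ) : ℂ) * (I * φ) := by
      push_cast; field_simp
    rw [this, Complex.im_ofReal_mul]
    have := Real.pi_pos
    simp only [Complex.I_mul_im]
    positivity
  set z : UpperHalfPlane := ⟨I * φ / (2 * (Real.pi : ℂ)), him⟩ with hzdef
  have hzc : (z : ℂ) = I * φ / (2 * (Real.pi : ℂ)) := rfl
  have hz : 2 * (Real.pi : ℂ) * I * z = -φ := by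
    rw [hzc]; field_simp; rw [I_sq]
  have hS : ((ModularGroup.S • z : UpperHalfPlane) : ℂ) = -1 / z := by
    rw [UpperHalfPlane.modular_S_smul]
    simp [neg_div]
  have hz' : 2 * (Real.pi : ℂ) * I * (ModularGroup.S • z : UpperHalfPlane)
      = -(4 * (Real.pi : ℂ) ^ 2 / φ) := by
    rw [hS, hzc]; field_simp; norm_num
  have hφ' : 0 < (4 * (Real.pi : ℂ) ^ 2 / φ).re := by
    have : 4 * (Real.pi : ℂ) ^ 2 / φ = ((4 * Real.pi ^ 2 : ℝ) : ℂ) * φ⁻¹ := by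
      push_cast; field_simp
    rw [this, Complex.re_ofReal_mul, Complex.inv_re]
    have := Real.pi_pos
    have := Complex.normSq_pos.mpr h0
    positivity
  rw [S2aux_sum φ hφ z hz, S2aux_sum _ hφ' _ hz', riemannZeta_two]
  have hT := EisensteinSeries.G2_S_transform z
  rw [hT, hzc]
  have hI : I ^ 2 = -1 := I_sq
  generalize EisensteinSeries.G2 (ModularGroup.S • z) = G
  have e1 : ((I * φ / (2 * (Real.pi : ℂ))) ^ 2)⁻¹ = -(4 * (Real.pi : ℂ) ^ 2 / φ ^ 2) := by
    rw [div_pow, mul_pow, I_sq]; field_simp; norm_num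
  have e2 : -2 * (Real.pi : ℂ) * I / (I * φ / (2 * (Real.pi : ℂ))) = -(4 * (Real.pi : ℂ) ^ 2 / φ) := by
    field_simp; norm_num
  rw [e1, e2]
  field_simp
  ring
end

section
/- For complex φ with Re(φ) > 0 and integer m ≥ 0, the Lambert series satisfies the functional equation L(2m+1, e^{-φ}) = -(-1)^m (2π/φ)^{2m+2} L(2m+1, e^{-4π²/φ}) - δ_{m,0}/(2φ) + (1/2)(B_{2m+2}/(2m+2))·[1 + (-1)^m (2π)^{2m+2}/φ^{2m+2}], where L(s,q) = Σ_{k≥1} k^s q^k/(1-q^k) and B_{2m+2} is a Bernoulli number. -/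
open Complex in
/-- The Lambert series `L(s,q) = Σ_{k≥1} k^s q^k/(1-q^k)`. -/
noncomputable def lambertSeries (s : ℕ) (q : ℂ) : ℂ :=
  ∑' k : ℕ, ((k + 1 : ℕ) : ℂ) ^ s * q ^ (k + 1) / (1 - q ^ (k + 1))

open scoped ArithmeticFunction.sigma in
lemma lambert_eq_sigma (s : ℕ) {q : ℂ} (hq : ‖q‖ < 1) :
    lambertSeries s q = ∑' n : ℕ+, (σ s n : ℂ) * q ^ (n : ℕ) := by
  rw [← tsum_pow_div_one_sub_eq_tsum_sigma hq s,
    tsum_pnat_eq_tsum_succ (f := fun n : ℕ => (n : ℂ) ^ s * q ^ n / (1 - q ^ n))]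
  rfl

lemma lambert_E2 (z : UpperHalfPlane) :
    EisensteinSeries.G2 z = 2 * riemannZeta 2 -
      8 * (Real.pi : ℂ) ^ 2 * lambertSeries 1 (Complex.exp (2 * Real.pi * Complex.I * z)) := by
  rw [EisensteinSeries.G2_eq_tsum_cexp,
    lambert_eq_sigma 1 (UpperHalfPlane.norm_exp_two_pi_I_lt_one z)]

lemma bernoulli_even_ne (m : ℕ) : ((bernoulli (2 * m + 2) : ℚ) : ℂ) ≠ 0 := by
  intro h
  have h1 := riemannZeta_two_mul_nat (k := m + 1) (by simp)
  rw [show 2 * (m + 1) = 2 * m + 2 by ring, h] at h1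
  refine riemannZeta_ne_zero_of_one_lt_re (s := 2 * ((m + 1 : ℕ) : ℂ)) ?_ (by simpa using h1)
  rw [show (2 * ((m + 1 : ℕ) : ℂ)) = ((2 * (m + 1) : ℕ) : ℂ) by push_cast; ring,
    Complex.natCast_re]
  norm_cast
  omega

lemma lambert_E (m : ℕ) (hm : 3 ≤ 2 * m + 2) (z : UpperHalfPlane) :
    ModularForm.E hm z = 1 - 2 * (2 * m + 2) / ((bernoulli (2 * m + 2) : ℚ) : ℂ) *
      lambertSeries (2 * m + 1) (Complex.exp (2 * Real.pi * Complex.I * z)) := by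
  rw [EisensteinSeries.q_expansion_bernoulli hm ⟨m + 1, by ring⟩,
    lambert_eq_sigma _ (UpperHalfPlane.norm_exp_two_pi_I_lt_one z)]
  simp

lemma E_S (k : ℕ) (hk : 3 ≤ k) (z : UpperHalfPlane) :
    ModularForm.E hk z = ModularForm.E hk (ModularGroup.S • z) * ((z : ℂ) ^ k)⁻¹ := by
  have h := congr_fun (SlashInvariantForm.slash_action_eqn (ModularForm.E hk)
    (ModularGroup.S : Matrix.GeneralLinearGroup (Fin 2) ℝ) ⟨ModularGroup.S, rfl⟩) z
  have h2 := SlashInvariantForm.slash_S_apply (ModularForm.E hk) k z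
  rw [UpperHalfPlane.modular_S_smul, ← zpow_natCast, ← zpow_neg, ← h2]
  exact h.symm

open Complex in
/-- Ramanujan's functional equation for the Lambert series at odd positive argument:
`L(2m+1, e^{-φ}) = -(-1)^m (2π/φ)^{2m+2} L(2m+1, e^{-4π²/φ}) - δ_{m,0}/(2φ)
 + (1/2)(B_{2m+2}/(2m+2))·[1 + (-1)^m (2π)^{2m+2}/φ^{2m+2}]` for `Re φ > 0`. -/
theorem lambert_functional_equation (m : ℕ) (φ : ℂ) (hφ : 0 < φ.re) :
    lambertSeries (2 * m + 1) (Complex.exp (-φ)) =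
      -(-1) ^ m * (2 * (Real.pi : ℂ) / φ) ^ (2 * m + 2) *
          lambertSeries (2 * m + 1) (Complex.exp (-(4 * (Real.pi : ℂ) ^ 2 / φ))) -
        (if m = 0 then 1 / (2 * φ) else 0) +
        1 / 2 * (((bernoulli (2 * m + 2) : ℚ) : ℂ) / (2 * m + 2)) *
          (1 + (-1) ^ m * (2 * (Real.pi : ℂ)) ^ (2 * m + 2) / φ ^ (2 * m + 2)) := by
  have hφ0 : φ ≠ 0 := by rintro rfl; simp at hφ
  have hpi : (Real.pi : ℂ) ≠ 0 := by exact_mod_cast Real.pi_ne_zero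
  have him : 0 < (I * φ / (2 * Real.pi)).im := by
    rw [show I * φ / (2 * Real.pi) = ((1 / (2 * Real.pi) : ℝ) : ℂ) * (I * φ) by
      push_cast; field_simp]
    rw [Complex.im_ofReal_mul]
    have := Real.pi_pos
    simp only [mul_im, I_re, I_im]
    simp only [zero_mul, one_mul, zero_add]
    positivity
  obtain ⟨z, hz⟩ : ∃ z : UpperHalfPlane, (z : ℂ) = I * φ / (2 * Real.pi) := ⟨⟨_, him⟩, rfl⟩
  have hSz : ((ModularGroup.S • z : UpperHalfPlane) : ℂ) = 2 * Real.pi * I / φ := by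
    rw [UpperHalfPlane.modular_S_smul]
    change (-(z : ℂ))⁻¹ = _
    rw [hz]
    field_simp
    simp
  have e1 : 2 * Real.pi * I * (z : ℂ) = -φ := by
    rw [hz]; field_simp; simp
  have e2 : 2 * Real.pi * I * ((ModularGroup.S • z : UpperHalfPlane) : ℂ)
      = -(4 * (Real.pi : ℂ) ^ 2 / φ) := by
    rw [hSz]; field_simp; rw [I_sq]; ring
  rcases Nat.eq_zero_or_pos m with rfl | hm
  · have h := EisensteinSeries.G2_S_transform z
    rw [lambert_E2, lambert_E2, e1, e2, riemannZeta_two, hz] at h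
    have hb : bernoulli 2 = 1 / 6 := by simp [bernoulli_eq_bernoulli'_of_ne_one]
    simp only [mul_zero, zero_add, if_true, hb]
    push_cast
    generalize lambertSeries 1 (cexp (-φ)) = L1 at *
    generalize lambertSeries 1 (cexp (-(4 * (Real.pi : ℂ) ^ 2 / φ))) = L2 at *
    field_simp at h ⊢
    simp only [I_sq] at h
    linear_combination (1 / 2) * h
  · have hk : 3 ≤ 2 * m + 2 := by omega
    have h := E_S _ hk z
    rw [lambert_E, lambert_E, e1, e2, hz] at h
    have hB := bernoulli_even_ne m
    have hm2 : (2 * m + 2 : ℂ) ≠ 0 := by norm_cast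
    rw [if_neg hm.ne']
    generalize lambertSeries (2 * m + 1) (cexp (-φ)) = L1 at *
    generalize lambertSeries (2 * m + 1) (cexp (-(4 * (Real.pi : ℂ) ^ 2 / φ))) = L2 at *
    generalize ((bernoulli (2 * m + 2) : ℚ) : ℂ) = B at *
    have hI : (I : ℂ) ^ (2 * m + 2) = -(-1) ^ m := by
      rw [show 2 * m + 2 = 2 * (m + 1) by ring, pow_mul, I_sq, pow_succ]; ring
    have hinv : ((I * φ / (2 * Real.pi)) ^ (2 * m + 2))⁻¹
        = -(-1) ^ m * (2 * (Real.pi : ℂ) / φ) ^ (2 * m + 2) := by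
      rw [div_pow, mul_pow, hI, div_pow]
      have : ((-1 : ℂ) ^ m) * (-1) ^ m = 1 := by rw [← mul_pow]; simp
      have h1 : ((-1 : ℂ) ^ m) ≠ 0 := by simp
      have h2 : φ ^ (2 * m + 2) ≠ 0 := pow_ne_zero _ hφ0
      have h3 : (2 * (Real.pi : ℂ)) ^ (2 * m + 2) ≠ 0 := pow_ne_zero _ (mul_ne_zero two_ne_zero hpi)
      generalize ((-1 : ℂ) ^ m) = s at *
      field_simp
      linear_combination this
    rw [hinv] at h
    have h4 : (2 * (Real.pi : ℂ)) ^ (2 * m + 2) / φ ^ (2 * m + 2)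
      = (2 * (Real.pi : ℂ) / φ) ^ (2 * m + 2) := by rw [div_pow]
    rw [mul_div_assoc ((-1 : ℂ) ^ m), h4]
    generalize (2 * (Real.pi : ℂ) / φ) ^ (2 * m + 2) = X at *
    generalize ((-1 : ℂ) ^ m) = s at *
    field_simp at h ⊢
    linear_combination (-1) * h
end
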